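/- arXiv:2404.09399 — 3 statements merged into one kernel-verified Lean document; each statement's English description precedes it below -/
import Mathlib

section
/- Let d = p² with p prime. Then the set KD⁺ of KD classical density matrices equals the convex hull of A ∪ B ∪ C, i.e. KD⁺ = ConvHull(A ∪ B ∪ C). -/
open Complex Matrix
open scoped ComplexOrder

noncomputable section

/-- `omega n = exp(2 π i / n)`, a primitive `n`-th root of unity. -/
def omega (n : ℕ) : ℂ := Complex.exp (2 * Real.pi * Complex.I / n)

/-- The standard basis vector `a i` of `ℂ^d`. -/
def stdVec (d : ℕ) (i : Fin d) : Fin d → ℂ := fun k => if k = i then 1 else 0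

/-- The Fourier (DFT) basis vector `b j = (1/√d) ∑ i, ω_d^(i j) • a i`. -/
def fourierVec (d : ℕ) (j : Fin d) : Fin d → ℂ :=
  fun i => ((1 / Real.sqrt d : ℝ) : ℂ) * omega d ^ (i.val * j.val)

/-- The rank-one projector `|v⟩⟨v|` of a vector `v`, as a matrix. -/
def proj (d : ℕ) (v : Fin d → ℂ) : Matrix (Fin d) (Fin d) ℂ :=
  Matrix.of fun i k => v i * (starRingEnd ℂ) (v k)

/-- The Kirkwood-Dirac quasiprobability `Q i j F = ⟨b j|a i⟩ * ⟨a i|F|b j⟩`. -/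
def KDQ (d : ℕ) (F : Matrix (Fin d) (Fin d) ℂ) (i j : Fin d) : ℂ :=
  (starRingEnd ℂ) (fourierVec d j i) * ∑ k, F i k * fourierVec d j k

/-- The set `KD⁺` of KD classical density matrices: positive semidefinite, trace one,
and all KD quasiprobabilities are nonnegative reals. -/
def KDplus (d : ℕ) : Set (Matrix (Fin d) (Fin d) ℂ) :=
  {ρ | ρ.PosSemidef ∧ ρ.trace = 1 ∧
    ∀ i j, (KDQ d ρ i j).im = 0 ∧ 0 ≤ (KDQ d ρ i j).re}

/-- The set `KD^r` of self-adjoint operators whose KD distribution is everywhere real. -/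
def KDr (d : ℕ) : Set (Matrix (Fin d) (Fin d) ℂ) :=
  {F | F.IsHermitian ∧ ∀ i j, (KDQ d F i j).im = 0}

/-- `A = {|a i⟩⟨a i| : i ∈ ℤ_d}`. -/
def setA (d : ℕ) : Set (Matrix (Fin d) (Fin d) ℂ) :=
  {M | ∃ i : Fin d, M = proj d (stdVec d i)}

/-- `B = {|b j⟩⟨b j| : j ∈ ℤ_d}`. -/
def setB (d : ℕ) : Set (Matrix (Fin d) (Fin d) ℂ) :=
  {M | ∃ j : Fin d, M = proj d (fourierVec d j)}

/-- For `d = p * q` : `ψ m s = (1/√q) ∑ k ∈ ℤ_q, ω_q^(s k) • a (k p + m)`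
(so the `i`-th coordinate is nonzero iff `i ≡ m [MOD p]`, with `k = i / p`). -/
def psiPQ (d p q : ℕ) (m : Fin p) (s : Fin q) : Fin d → ℂ :=
  fun i => if i.val % p = m.val then
    ((1 / Real.sqrt q : ℝ) : ℂ) * omega q ^ (s.val * (i.val / p)) else 0

/-- For `d = p * q` : `φ m' s' = (1/√p) ∑ k ∈ ℤ_p, ω_p^(s' k) • a (k q + m')`. -/
def phiPQ (d p q : ℕ) (m' : Fin q) (s' : Fin p) : Fin d → ℂ :=
  fun i => if i.val % q = m'.val then
    ((1 / Real.sqrt p : ℝ) : ℂ) * omega p ^ (s'.val * (i.val / q)) else 0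

/-- For `d = p ^ 2` : `C = {|ψ m s⟩⟨ψ m s| : m, s ∈ ℤ_p}`. -/
def setC2 (d p : ℕ) : Set (Matrix (Fin d) (Fin d) ℂ) :=
  {M | ∃ m s : Fin p, M = proj d (psiPQ d p p m s)}

/-- For `d = p * q` : `C = {|ψ m s⟩⟨ψ m s| : m ∈ ℤ_p, s ∈ ℤ_q}`. -/
def setC (d p q : ℕ) : Set (Matrix (Fin d) (Fin d) ℂ) :=
  {M | ∃ (m : Fin p) (s : Fin q), M = proj d (psiPQ d p q m s)}

/-- For `d = p * q` : `D = {|φ m' s'⟩⟨φ m' s'| : m' ∈ ℤ_q, s' ∈ ℤ_p}`. -/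
def setD (d p q : ℕ) : Set (Matrix (Fin d) (Fin d) ℂ) :=
  {M | ∃ (m' : Fin q) (s' : Fin p), M = proj d (phiPQ d p q m' s')}

/-- Matrix entries in the Fourier basis: `⟨b k|G|b j⟩`. -/
def entryB (d : ℕ) (G : Matrix (Fin d) (Fin d) ℂ) (k j : Fin d) : ℂ :=
  ∑ i, ∑ l, (starRingEnd ℂ) (fourierVec d k i) * G i l * fourierVec d j l


section helpers

/-- Residue class mod `p`. -/
def cl (p : ℕ) {d : ℕ} (i : ZMod d) : ℕ := i.val % p

/-- The (rescaled) KD distribution on `ZMod d`. -/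
def qq {d : ℕ} [NeZero d] (G : ZMod d → ZMod d → ℂ) (i j : ZMod d) : ℂ :=
  ∑ t, G i (i + t) * ZMod.stdAddChar (j * t)

lemma chi_star {d : ℕ} [NeZero d] (x : ZMod d) :
    (starRingEnd ℂ) (ZMod.stdAddChar x) = ZMod.stdAddChar (-x) := by
  rw [AddChar.map_neg_eq_conj]

lemma dft_inj' {d : ℕ} [NeZero d] (f g : ZMod d → ℂ)
    (h : ∀ j : ZMod d, ∑ t, f t * ZMod.stdAddChar (j * t) = ∑ t, g t * ZMod.stdAddChar (j * t)) :
    f = g := by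
  apply (ZMod.dft (N := d) (E := ℂ)).injective
  ext j
  rw [ZMod.dft_apply, ZMod.dft_apply]
  have := h (-j)
  simp only [smul_eq_mul]
  convert this using 2 <;> ring_nf

lemma qq_inj {d : ℕ} [NeZero d] (G H : ZMod d → ZMod d → ℂ)
    (h : ∀ i j, qq G i j = qq H i j) : G = H := by
  ext i k
  have := congrFun (dft_inj' (fun t => G i (i + t)) (fun t => H i (i + t)) (fun j => h i j)) (k - i)
  simpa using this

lemma shift_one {d : ℕ} [NeZero d] (G : ZMod d → ZMod d → ℂ)
    (hG : ∀ i k, (starRingEnd ℂ) (G i k) = G k i)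
    (hr : ∀ i j, (starRingEnd ℂ) (qq G i j) = qq G i j) (i t : ZMod d) :
    G (i - t) i = G i (i + t) := by
  refine congrFun (dft_inj' (fun t => G (i - t) i) (fun t => G i (i + t)) (fun j => ?_)) t
  have h := hr i j
  unfold qq at h
  rw [← h, map_sum, ← Equiv.sum_comp (Equiv.neg (ZMod d))]
  refine Finset.sum_congr rfl fun t _ => ?_
  simp [hG, chi_star, sub_eq_add_neg]

lemma shift_many {d : ℕ} [NeZero d] (G : ZMod d → ZMod d → ℂ)
    (hG : ∀ i k, (starRingEnd ℂ) (G i k) = G k i)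
    (hr : ∀ i j, (starRingEnd ℂ) (qq G i j) = qq G i j) (i t y : ZMod d) :
    G (i + y * t) (i + y * t + t) = G i (i + t) := by
  have key : ∀ n : ℕ, G (i + n * t) (i + n * t + t) = G i (i + t) := by
    intro n
    induction n with
    | zero => simp
    | succ n ih =>
      rw [← ih, ← shift_one G hG hr]
      push_cast
      ring_nf
  simpa using key y.val

section sq

lemma cl_add {p d : ℕ} [NeZero d] (hd : d = p ^ 2) (i y : ZMod d) : cl p (i + (p : ZMod d) * y) = cl p i := by
  have hpd : p ∣ d := hd ▸ Dvd.intro_left (p ^ 1) (by ring)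
  unfold cl
  have : ∀ x : ZMod d, ((x.val : ℕ) : ZMod p) = ZMod.castHom hpd (ZMod p) x := by
    intro x; simp
  change _ ≡ _ [MOD p]
  rw [← ZMod.natCast_eq_natCast_iff, this, this, map_add, map_mul, map_natCast]
  simp

lemma cl_ex {p d : ℕ} [NeZero d] (hd : d = p ^ 2) (i j : ZMod d) (h : cl p i = cl p j) : ∃ y : ZMod d, j = i + p * y := by
  have hi : (i : ZMod d) = (p : ZMod d) * (i.val / p : ℕ) + (i.val % p : ℕ) := by
    rw [← Nat.cast_mul, ← Nat.cast_add, Nat.div_add_mod]; simp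
  have hj : (j : ZMod d) = (p : ZMod d) * (j.val / p : ℕ) + (j.val % p : ℕ) := by
    rw [← Nat.cast_mul, ← Nat.cast_add, Nat.div_add_mod]; simp
  unfold cl at h
  refine ⟨(j.val / p : ℕ) - (i.val / p : ℕ), ?_⟩
  rw [← h] at hj
  linear_combination hj - hi

lemma pp_zero {p d : ℕ} [NeZero d] (hd : d = p ^ 2) : (p : ZMod d) * p = 0 := by
  rw [← Nat.cast_mul, ← sq, ← hd]; simp


lemma cl_natCast {p d : ℕ} [NeZero d] (hp : p.Prime) (hd : d = p ^ 2) (s : ℕ) (hs : s < p) : cl p (s : ZMod d) = s := by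
  unfold cl
  rw [ZMod.val_natCast, Nat.mod_mod_of_dvd _ (hd ▸ Dvd.intro_left (p ^ 1) (by ring)),
    Nat.mod_eq_of_lt hs]

lemma cl_zero {p d : ℕ} [NeZero d] (hp : p.Prime) (hd : d = p ^ 2) : cl p (0 : ZMod d) = 0 := by simp [cl]

lemma unit_of_cl {p d : ℕ} [NeZero d] (hp : p.Prime) (hd : d = p ^ 2) (t : ZMod d) (h : cl p t ≠ 0) : IsUnit t := by
  rw [← ZMod.natCast_zmod_val t, ZMod.isUnit_iff_coprime]
  suffices h2 : t.val.Coprime (p ^ 2) by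
    convert h2
  apply Nat.Coprime.pow_right
  rw [Nat.coprime_comm, hp.coprime_iff_not_dvd]
  intro h'
  exact h (Nat.mod_eq_zero_of_dvd h')

lemma pmul_eq_zero {p d : ℕ} [NeZero d] (hp : p.Prime) (hd : d = p ^ 2) (y : ZMod d) (h : (p : ZMod d) * y = 0) : cl p y = 0 := by
  by_contra h0
  have hu := unit_of_cl hp hd y h0
  have : (p : ZMod d) = 0 := by simpa [hu.mul_left_eq_zero] using h
  rw [ZMod.natCast_eq_zero_iff, hd] at this
  have h1 := Nat.le_of_dvd hp.pos this
  nlinarith [hp.two_le]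

lemma cl_mul_of {p d : ℕ} [NeZero d] (hp : p.Prime) (hd : d = p ^ 2) (x t : ZMod d) (hx : cl p x = 0) (ht : cl p t = 0) : x * t = 0 := by
  obtain ⟨a, ha⟩ := cl_ex (p := p) hd 0 x (by rw [cl_zero hp hd, hx])
  obtain ⟨b, hb⟩ := cl_ex (p := p) hd 0 t (by rw [cl_zero hp hd, ht])
  rw [ha, hb]
  linear_combination a * b * pp_zero (p := p) (d := d) hd

lemma cl_sub {p d : ℕ} [NeZero d] (hp : p.Prime) (hd : d = p ^ 2) (i j : ZMod d) : cl p (i - j) = 0 ↔ cl p i = cl p j := by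
  constructor
  · intro h
    obtain ⟨a, ha⟩ := cl_ex (p := p) hd 0 (i - j) (by rw [cl_zero hp hd, h])
    rw [show i = j + p * a by linear_combination ha, cl_add hd]
  · intro h
    obtain ⟨a, ha⟩ := cl_ex (p := p) hd j i h.symm
    rw [show i - j = 0 + p * a by linear_combination ha, cl_add hd, cl_zero hp hd]

/-- diagonals with unit offset are constant -/
lemma diag_unit {p d : ℕ} [NeZero d] (hp : p.Prime) (hd : d = p ^ 2) (G : ZMod d → ZMod d → ℂ)
    (hG : ∀ i k, (starRingEnd ℂ) (G i k) = G k i)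
    (hr : ∀ i j, (starRingEnd ℂ) (qq G i j) = qq G i j) (i i' t : ZMod d) (ht : cl p t ≠ 0) :
    G i' (i' + t) = G i (i + t) := by
  obtain ⟨u, hu⟩ := (unit_of_cl hp hd t ht).exists_left_inv
  have := shift_many G hG hr i t ((i' - i) * u)
  rw [show i + (i' - i) * u * t = i' by linear_combination (i' - i) * hu] at this
  exact this

/-- nonzero diagonals depend only on the class -/
lemma diag_cl {p d : ℕ} [NeZero d] (hp : p.Prime) (hd : d = p ^ 2) (G : ZMod d → ZMod d → ℂ)
    (hG : ∀ i k, (starRingEnd ℂ) (G i k) = G k i)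
    (hr : ∀ i j, (starRingEnd ℂ) (qq G i j) = qq G i j) (i i' t : ZMod d) (ht : t ≠ 0)
    (hi : cl p i = cl p i') :
    G i' (i' + t) = G i (i + t) := by
  by_cases h : cl p t = 0
  · obtain ⟨a, ha⟩ := cl_ex (p := p) hd 0 t (by rw [cl_zero hp hd, h])
    have ha0 : cl p a ≠ 0 := by
      intro h0
      apply ht
      obtain ⟨b, hb⟩ := cl_ex (p := p) hd 0 a (by rw [cl_zero hp hd, h0])
      rw [ha, hb]
      linear_combination b * pp_zero (p := p) (d := d) hd
    obtain ⟨u, hu⟩ := (unit_of_cl hp hd a ha0).exists_left_inv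
    obtain ⟨y, hy⟩ := cl_ex (p := p) hd i i' hi
    have := shift_many G hG hr i t (y * u)
    rw [show i + y * u * t = i' by rw [ha, hy]; linear_combination y * p * hu] at this
    exact this
  · exact diag_unit hp hd G hG hr i i' t h

lemma row_diff {p d : ℕ} [NeZero d] (hp : p.Prime) (hd : d = p ^ 2) (G : ZMod d → ZMod d → ℂ)
    (hG : ∀ i k, (starRingEnd ℂ) (G i k) = G k i)
    (hr : ∀ i j, (starRingEnd ℂ) (qq G i j) = qq G i j) (i i' j : ZMod d)
    (hi : cl p i = cl p i') :
    qq G i j - qq G i' j = G i i - G i' i' := by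
  unfold qq
  rw [← Finset.sum_sub_distrib, Finset.sum_eq_single 0]
  · simp
  · intro t _ ht
    rw [diag_cl hp hd G hG hr i i' t ht hi, sub_self]
  · simp

lemma col_diff {p d : ℕ} [NeZero d] (hp : p.Prime) (hd : d = p ^ 2) (G : ZMod d → ZMod d → ℂ)
    (hG : ∀ i k, (starRingEnd ℂ) (G i k) = G k i)
    (hr : ∀ i j, (starRingEnd ℂ) (qq G i j) = qq G i j) (i i' j j' : ZMod d)
    (hj : cl p j = cl p j') :
    qq G i j - qq G i j' = qq G i' j - qq G i' j' := by
  unfold qq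
  rw [← Finset.sum_sub_distrib, ← Finset.sum_sub_distrib]
  refine Finset.sum_congr rfl fun t _ => ?_
  by_cases h : cl p t = 0
  · have : (j - j') * t = 0 := cl_mul_of hp hd _ _ ((cl_sub hp hd j j').2 hj) h
    rw [show j * t = j' * t by linear_combination this]
    simp
  · rw [diag_unit hp hd G hG hr i i' t h]

lemma card_cl {p d : ℕ} [NeZero d] (hp : p.Prime) (hd : d = p ^ 2) (m : ℕ) (hm : m < p) :
    (Finset.univ.filter fun t : ZMod d => cl p t = m).card = p := by
  symm
  conv_lhs => rw [← Finset.card_range p]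
  have hlt : ∀ a < p, m + p * a < d := by
    intro a ha
    rw [hd]
    nlinarith
  refine Finset.card_bij (fun a _ => ((m + p * a : ℕ) : ZMod d)) ?_ ?_ ?_
  · intro a ha
    simp only [Finset.mem_filter, Finset.mem_univ, true_and]
    push_cast
    rw [cl_add hd, cl_natCast hp hd m hm]
  · intro a ha b hb hab
    have := congrArg ZMod.val hab
    simp only [Finset.mem_range] at ha hb this
    rw [ZMod.val_cast_of_lt (hlt a ha), ZMod.val_cast_of_lt (hlt b hb)] at this
    have := Nat.add_left_cancel this
    exact Nat.eq_of_mul_eq_mul_left hp.pos this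
  · intro t ht
    simp only [Finset.mem_filter, Finset.mem_univ, true_and] at ht
    refine ⟨t.val / p, ?_, ?_⟩
    · simp only [Finset.mem_range]
      rw [Nat.div_lt_iff_lt_mul hp.pos, ← sq, ← hd]
      exact ZMod.val_lt t
    · rw [← ht]; unfold cl; rw [Nat.mod_add_div]; simp

lemma sum_cl {p d : ℕ} [NeZero d] (hp : p.Prime) (hd : d = p ^ 2) (x : ZMod d) :
    ∑ t : ZMod d, (if cl p t = 0 then (ZMod.stdAddChar (x * t) : ℂ) else 0)
      = if cl p x = 0 then (p : ℂ) else 0 := by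
  split_ifs with hx
  · have : ∀ t : ZMod d, (if cl p t = 0 then (ZMod.stdAddChar (x * t) : ℂ) else 0)
        = if cl p t = 0 then 1 else 0 := by
      intro t
      split_ifs with h
      · rw [cl_mul_of hp hd x t hx h]; simp
      · rfl
    simp only [this]
    rw [Finset.sum_boole, card_cl hp hd 0 hp.pos]
  · set S := ∑ t : ZMod d, (if cl p t = 0 then (ZMod.stdAddChar (x * t) : ℂ) else 0) with hS
    have h1 : S = ZMod.stdAddChar (x * (p : ZMod d)) * S := by
      conv_lhs => rw [hS, ← Equiv.sum_comp (Equiv.addRight (p : ZMod d))]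
      rw [hS, Finset.mul_sum]
      refine Finset.sum_congr rfl fun t _ => ?_
      have := cl_add (p := p) hd t 1
      rw [mul_one] at this
      simp only [Equiv.coe_addRight, this, mul_add, AddChar.map_add_eq_mul]
      split_ifs
      · ring
      · ring
    have h2 : (ZMod.stdAddChar (x * (p : ZMod d)) : ℂ) ≠ 1 := by
      intro h
      rw [← (ZMod.stdAddChar (N := d)).map_zero_eq_one, ZMod.injective_stdAddChar.eq_iff] at h
      exact hx (pmul_eq_zero hp hd x (by rw [mul_comm]; exact h))
    have h3 : (ZMod.stdAddChar (x * (p : ZMod d)) - 1) * S = 0 := by linear_combination -h1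
    rcases mul_eq_zero.1 h3 with h | h
    · exact absurd (sub_eq_zero.1 h) h2
    · exact h

end sq

/-- kernel of `|a i0⟩⟨a i0|` -/
def gA {d : ℕ} (i0 : ZMod d) (i k : ZMod d) : ℂ := (if i = i0 then 1 else 0) * if k = i0 then 1 else 0

/-- kernel of `|b j0⟩⟨b j0|` -/
def gB {d : ℕ} [NeZero d] (j0 : ZMod d) (i k : ZMod d) : ℂ :=
  (1 / d : ℂ) * ZMod.stdAddChar (j0 * (i - k))

/-- kernel of `|ψ m s⟩⟨ψ m s|` -/
def gC (p : ℕ) {d : ℕ} [NeZero d] (m s : Fin p) (i k : ZMod d) : ℂ :=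
  if cl p i = m.val ∧ cl p k = m.val then
    (1 / p : ℂ) * ZMod.stdAddChar (((s.val : ℕ) : ZMod d) * (i - k)) else 0

lemma qq_gA {d : ℕ} [NeZero d] (i0 i j : ZMod d) : qq (gA i0) i j = if i = i0 then 1 else 0 := by
  unfold qq gA
  split_ifs with h
  · subst h
    simp
  · simp

lemma qq_gB {d : ℕ} [NeZero d] (j0 i j : ZMod d) : qq (gB j0) i j = if j = j0 then 1 else 0 := by
  unfold qq gB
  have : ∀ t : ZMod d, (1 / d : ℂ) * ZMod.stdAddChar (j0 * (i - (i + t))) * ZMod.stdAddChar (j * t)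
      = (1 / d : ℂ) * ZMod.stdAddChar (t * (j - j0)) := by
    intro t
    rw [mul_assoc, ← AddChar.map_add_eq_mul]
    congr 2
    ring
  simp only [this]
  have hd0 : (d : ℂ) ≠ 0 := NeZero.ne _
  rw [← Finset.mul_sum, AddChar.sum_mulShift _ (ZMod.isPrimitive_stdAddChar d)]
  simp only [sub_eq_zero, ZMod.card]
  split_ifs <;> simp [hd0]

lemma qq_gC {p d : ℕ} [NeZero d] (hp : p.Prime) (hd : d = p ^ 2) (m s : Fin p) (i j : ZMod d) :
    qq (gC p m s) i j = if cl p i = m.val ∧ cl p j = s.val then 1 else 0 := by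
  unfold qq gC
  by_cases hi : cl p i = m.val
  · have : ∀ t : ZMod d, (if cl p i = m.val ∧ cl p (i + t) = m.val then
        (1 / p : ℂ) * ZMod.stdAddChar (((s.val : ℕ) : ZMod d) * (i - (i + t))) else 0)
          * ZMod.stdAddChar (j * t)
        = (1 / p : ℂ) * (if cl p t = 0 then
          (ZMod.stdAddChar ((j - ((s.val : ℕ) : ZMod d)) * t) : ℂ) else 0) := by
      intro t
      have h1 : cl p (i + t) = m.val ↔ cl p t = 0 := by
        rw [← hi, ← cl_sub hp hd]; simp
      simp only [hi, h1, true_and]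
      split_ifs
      · rw [mul_assoc, ← AddChar.map_add_eq_mul]
        congr 2
        ring
      · simp
    simp only [this]
    rw [← Finset.mul_sum, sum_cl hp hd]
    simp only [cl_sub hp hd, cl_natCast hp hd _ s.2]
    have hp0 : (p : ℂ) ≠ 0 := by exact_mod_cast hp.ne_zero
    simp only [hi, true_and]
    split_ifs <;> simp [hp0]
  · simp [hi]

/-- Main decomposition. -/
lemma decomp {p d : ℕ} [NeZero d] (hp : p.Prime) (hd : d = p ^ 2) (G : ZMod d → ZMod d → ℂ)
    (hG : ∀ i k, (starRingEnd ℂ) (G i k) = G k i)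
    (hr : ∀ i j, (qq G i j).im = 0) (hpos : ∀ i j, 0 ≤ (qq G i j).re) :
    ∃ (α β : ZMod d → ℝ) (γ : Fin p → Fin p → ℝ),
      (∀ i, 0 ≤ α i) ∧ (∀ j, 0 ≤ β j) ∧ (∀ m s, 0 ≤ γ m s) ∧
      ∀ i k, G i k = ∑ i0, (α i0 : ℂ) * gA i0 i k + ∑ j0, (β j0 : ℂ) * gB j0 i k
        + ∑ m, ∑ s, (γ m s : ℂ) * gC p m s i k := by
  have hr' : ∀ i j, (starRingEnd ℂ) (qq G i j) = qq G i j :=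
    fun i j => Complex.conj_eq_iff_im.2 (hr i j)
  have hre : ∀ i j, ((qq G i j).re : ℂ) = qq G i j :=
    fun i j => Complex.conj_eq_iff_re.1 (hr' i j)
  have hrow : ∀ i i' j j' : ZMod d, cl p i = cl p i' →
      (qq G i j).re - (qq G i' j).re = (qq G i j').re - (qq G i' j').re := by
    intro i i' j j' h
    rw [← Complex.sub_re, ← Complex.sub_re, row_diff hp hd G hG hr' i i' j h,
      row_diff hp hd G hG hr' i i' j' h]
  have hcol : ∀ i i' j j' : ZMod d, cl p j = cl p j' →
      (qq G i j).re - (qq G i j').re = (qq G i' j).re - (qq G i' j').re := by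
    intro i i' j j' h
    rw [← Complex.sub_re, ← Complex.sub_re, col_diff hp hd G hG hr' i i' j j' h]
  have hmin : ∀ (f : ZMod d → ℝ) (m : Fin p), ∃ x : ZMod d, cl p x = m.val ∧
      ∀ y, cl p y = m.val → f x ≤ f y := by
    intro f m
    have hne : (Finset.univ.filter fun t : ZMod d => cl p t = m.val).Nonempty :=
      ⟨((m.val : ℕ) : ZMod d), by simp [cl_natCast hp hd _ m.2]⟩
    obtain ⟨x, hx, hx'⟩ := Finset.exists_min_image _ f hne
    simp only [Finset.mem_filter, Finset.mem_univ, true_and] at hx hx'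
    exact ⟨x, hx, hx'⟩
  choose im him him' using hmin (fun i => (qq G i 0).re)
  choose jm hjm hjm' using hmin (fun j => (qq G 0 j).re)
  let c : ZMod d → Fin p := fun i => ⟨cl p i, Nat.mod_lt _ hp.pos⟩
  have hc : ∀ i, (c i).val = cl p i := fun i => rfl
  let α : ZMod d → ℝ := fun i => (qq G i 0).re - (qq G (im (c i)) 0).re
  let β : ZMod d → ℝ := fun j => (qq G 0 j).re - (qq G 0 (jm (c j))).re
  let γ : Fin p → Fin p → ℝ := fun m s => (qq G (im m) (jm s)).re
  refine ⟨α, β, γ, fun i => ?_, fun j => ?_, fun m s => hpos _ _, ?_⟩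
  · exact sub_nonneg.2 (him' (c i) i (hc i).symm)
  · exact sub_nonneg.2 (hjm' (c j) j (hc j).symm)
  · have := qq_inj G (fun i k => ∑ i0, (α i0 : ℂ) * gA i0 i k + ∑ j0, (β j0 : ℂ) * gB j0 i k
        + ∑ m, ∑ s, (γ m s : ℂ) * gC p m s i k) ?_
    · intro i k
      exact congrFun (congrFun this i) k
    · intro i j
      have e : qq (fun i k => ∑ i0, (α i0 : ℂ) * gA i0 i k + ∑ j0, (β j0 : ℂ) * gB j0 i k
          + ∑ m, ∑ s, (γ m s : ℂ) * gC p m s i k) i j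
          = ∑ i0, (α i0 : ℂ) * qq (gA i0) i j + ∑ j0, (β j0 : ℂ) * qq (gB j0) i j
          + ∑ m, ∑ s, (γ m s : ℂ) * qq (gC p m s) i j := by
        unfold qq
        simp only [add_mul, Finset.sum_add_distrib, Finset.sum_mul, Finset.mul_sum, mul_assoc]
        congr 1
        · congr 1
          · exact Finset.sum_comm
          · exact Finset.sum_comm
        · rw [Finset.sum_comm]
          exact Finset.sum_congr rfl fun _ _ => Finset.sum_comm
      rw [e]
      have e2 : ∀ m s : Fin p, (if cl p i = m.val ∧ cl p j = s.val then (1 : ℂ) else 0)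
          = if c i = m then (if c j = s then 1 else 0) else 0 := by
        intro m s
        simp only [Fin.ext_iff, hc]
        split_ifs <;> simp_all
      simp only [qq_gA, qq_gB, qq_gC hp hd, e2]
      simp only [mul_ite, mul_one, mul_zero, Finset.sum_ite_eq, Finset.mem_univ, if_true,
        Finset.sum_ite_irrel, Finset.sum_const_zero]
      rw [← hre i j, ← Complex.ofReal_add, ← Complex.ofReal_add]
      congr 1
      have h1 := hrow i (im (c i)) 0 j (by rw [him, hc])
      have h2 := hcol 0 (im (c i)) j (jm (c j)) (by rw [hjm, hc])
      simp only [α, β, γ]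
      linarith

section bridge
variable {n : ℕ}

lemma omega_pow (d : ℕ) [NeZero d] (k : ℕ) : omega d ^ k = ZMod.stdAddChar (k : ZMod d) := by
  have := ZMod.stdAddChar_coe (N := d) (k : ℤ)
  simp only [Int.cast_natCast] at this
  rw [this, omega, ← Complex.exp_nat_mul]
  congr 1
  ring

lemma fourier_eq (i j : ZMod (n + 1)) :
    fourierVec (n + 1) j i = ((1 / Real.sqrt (n + 1 : ℕ) : ℝ) : ℂ) * ZMod.stdAddChar (i * j) := by
  unfold fourierVec
  rw [omega_pow]
  congr 2

lemma sqrt_sq_inv (d : ℕ) : ((1 / Real.sqrt d : ℝ) : ℂ) * ((1 / Real.sqrt d : ℝ) : ℂ)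
    = 1 / (d : ℂ) := by
  rw [← Complex.ofReal_mul, div_mul_div_comm, Real.mul_self_sqrt (Nat.cast_nonneg d)]
  simp

lemma KDQ_eq (F : Matrix (Fin (n + 1)) (Fin (n + 1)) ℂ) (i j : ZMod (n + 1)) :
    KDQ (n + 1) F i j = (1 / ((n + 1 : ℕ) : ℂ)) * qq (d := n + 1) F i j := by
  have h : KDQ (n + 1) F i j = (starRingEnd ℂ) (fourierVec (n + 1) j i) *
    ∑ k : ZMod (n + 1), F i k * fourierVec (n + 1) j k := rfl
  rw [h, fourier_eq, ← Equiv.sum_comp (Equiv.addLeft (i : ZMod (n + 1)))]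
  unfold qq
  rw [Finset.mul_sum, Finset.mul_sum]
  refine Finset.sum_congr rfl fun t _ => ?_
  rw [Equiv.coe_addLeft, fourier_eq, map_mul, chi_star, Complex.conj_ofReal, ← sqrt_sq_inv]
  rw [show j * t = -(i * j) + (i + t) * j by ring, AddChar.map_add_eq_mul]
  ring

lemma projA (i0 i k : ZMod (n + 1)) : proj (n + 1) (stdVec (n + 1) i0) i k = gA i0 i k := by
  have h : proj (n + 1) (stdVec (n + 1) i0) i k
    = (if i = i0 then 1 else 0) * (starRingEnd ℂ) (if k = i0 then 1 else 0) := rfl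
  rw [h]
  unfold gA
  split_ifs <;> simp

lemma projB (i0 i k : ZMod (n + 1)) : proj (n + 1) (fourierVec (n + 1) i0) i k = gB i0 i k := by
  have h : proj (n + 1) (fourierVec (n + 1) i0) i k
    = fourierVec (n + 1) i0 i * (starRingEnd ℂ) (fourierVec (n + 1) i0 k) := rfl
  rw [h, fourier_eq, fourier_eq, map_mul (starRingEnd ℂ), chi_star, Complex.conj_ofReal]
  unfold gB
  rw [← sqrt_sq_inv, show i0 * (i - k) = i * i0 + -(k * i0) by ring, AddChar.map_add_eq_mul]
  ring

lemma omega_p {p d : ℕ} [NeZero d] (hp : p.Prime) (hd : d = p ^ 2) (k : ℕ) :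
    omega p ^ k = ZMod.stdAddChar ((p * k : ℕ) : ZMod d) := by
  rw [← omega_pow, pow_mul]
  congr 1
  unfold omega
  rw [← Complex.exp_nat_mul, hd]
  congr 1
  have hp0 : (p : ℂ) ≠ 0 := by exact_mod_cast hp.ne_zero
  push_cast
  field_simp

lemma psi_eq {p : ℕ} (hp : p.Prime) (hd : n + 1 = p ^ 2) (m s : Fin p) (i : ZMod (n + 1)) :
    psiPQ (n + 1) p p m s i = if cl p i = m.val then ((1 / Real.sqrt p : ℝ) : ℂ) *
      ZMod.stdAddChar (((s.val : ℕ) : ZMod (n + 1)) * (i - ((m.val : ℕ) : ZMod (n + 1)))) else 0 := by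
  have h : psiPQ (n + 1) p p m s i = if cl p i = m.val then
    ((1 / Real.sqrt p : ℝ) : ℂ) * omega p ^ (s.val * (i.val / p)) else 0 := rfl
  rw [h]
  split_ifs with hi
  · rw [omega_p hp hd]
    congr 2
    have h2 : ((p * (i.val / p) + i.val % p : ℕ) : ZMod (n + 1)) = i := by
      rw [Nat.div_add_mod]; exact ZMod.natCast_zmod_val i
    unfold cl at hi
    rw [hi] at h2
    push_cast at h2 ⊢
    linear_combination ((s.val : ℕ) : ZMod (n + 1)) * h2
  · rfl

lemma projC {p : ℕ} (hp : p.Prime) (hd : n + 1 = p ^ 2) (m s : Fin p) (i k : ZMod (n + 1)) :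
    proj (n + 1) (psiPQ (n + 1) p p m s) i k = gC p m s i k := by
  have h : proj (n + 1) (psiPQ (n + 1) p p m s) i k
    = psiPQ (n + 1) p p m s i * (starRingEnd ℂ) (psiPQ (n + 1) p p m s k) := rfl
  rw [h, psi_eq hp hd, psi_eq hp hd]
  unfold gC
  by_cases h1 : cl p i = m.val <;> by_cases h2 : cl p k = m.val
  · simp only [h1, h2, if_true, and_self]
    rw [map_mul (starRingEnd ℂ), chi_star, Complex.conj_ofReal, ← sqrt_sq_inv,
      show ((s.val : ℕ) : ZMod (n + 1)) * (i - k)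
        = ((s.val : ℕ) : ZMod (n + 1)) * (i - ((m.val : ℕ) : ZMod (n + 1)))
          + -(((s.val : ℕ) : ZMod (n + 1)) * (k - ((m.val : ℕ) : ZMod (n + 1)))) by ring,
      AddChar.map_add_eq_mul]
    ring
  all_goals simp [h1, h2]

lemma proj_psd (d : ℕ) (v : Fin d → ℂ) : (proj d v).PosSemidef :=
  Matrix.posSemidef_vecMulVec_self_star v

/-- membership in `KDplus` from a zero-one table -/
lemma mem_of (v : Fin (n + 1) → ℂ) (G : ZMod (n + 1) → ZMod (n + 1) → ℂ)
    (h : ∀ i k : ZMod (n + 1), proj (n + 1) v i k = G i k)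
    (ht : ∑ i, G i i = 1)
    (P : ZMod (n + 1) → ZMod (n + 1) → Prop) [∀ i j, Decidable (P i j)]
    (hq : ∀ i j, qq G i j = if P i j then 1 else 0) :
    proj (n + 1) v ∈ KDplus (n + 1) := by
  refine ⟨proj_psd _ _, ?_, ?_⟩
  · rw [← ht]
    exact Finset.sum_congr rfl fun i _ => h i i
  · intro (i : ZMod (n + 1)) (j : ZMod (n + 1))
    have e : (proj (n + 1) v : ZMod (n + 1) → ZMod (n + 1) → ℂ) = G := by
      funext i k; exact h i k
    have e2 : KDQ (n + 1) (proj (n + 1) v) i j = (1 / ((n + 1 : ℕ) : ℂ)) * qq (d := n + 1) G i j := by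
      rw [← e]; exact KDQ_eq _ i j
    rw [e2, hq]
    rw [show (1 / ((n + 1 : ℕ) : ℂ)) = ((1 / ((n + 1 : ℕ) : ℝ) : ℝ) : ℂ) by push_cast; rfl]
    split_ifs
    · rw [mul_one]
      exact ⟨Complex.ofReal_im _, by rw [Complex.ofReal_re]; positivity⟩
    · simp

lemma memA (i0 : ZMod (n + 1)) : proj (n + 1) (stdVec (n + 1) i0) ∈ KDplus (n + 1) := by
  refine mem_of _ (gA i0) (projA i0) ?_ (fun i _ => i = i0) (fun i j => by rw [qq_gA])
  simp [gA]

lemma memB (j0 : ZMod (n + 1)) : proj (n + 1) (fourierVec (n + 1) j0) ∈ KDplus (n + 1) := by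
  refine mem_of _ (gB j0) (projB j0) ?_ (fun _ j => j = j0) (fun i j => by rw [qq_gB])
  have h0 : ((n : ℂ) + 1) ≠ 0 := by exact_mod_cast Nat.succ_ne_zero n
  simp only [gB, sub_self, mul_zero, AddChar.map_zero_eq_one, Finset.sum_const, Finset.card_univ,
    ZMod.card, nsmul_eq_mul]
  push_cast
  field_simp

lemma memC {p : ℕ} (hp : p.Prime) (hd : n + 1 = p ^ 2) (m s : Fin p) :
    proj (n + 1) (psiPQ (n + 1) p p m s) ∈ KDplus (n + 1) := by
  refine mem_of _ (gC p m s) (projC hp hd m s) ?_ (fun i j => cl p i = m.val ∧ cl p j = s.val)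
    (fun i j => by rw [qq_gC hp hd])
  have h0 : (p : ℂ) ≠ 0 := by exact_mod_cast hp.ne_zero
  simp only [gC, sub_self, mul_zero, AddChar.map_zero_eq_one, and_self, mul_one]
  rw [← Finset.sum_filter, Finset.sum_const, card_cl hp hd m.val m.2, nsmul_eq_mul]
  field_simp

lemma KDplus_convex (d : ℕ) : Convex ℝ (KDplus d) := by
  rintro F ⟨h1, h2, h3⟩ H ⟨k1, k2, k3⟩ a b ha hb hab
  refine ⟨(h1.smul ha).add (k1.smul hb), ?_, ?_⟩
  · rw [Matrix.trace_add, Matrix.trace_smul, Matrix.trace_smul, h2, k2, ← add_smul, hab, one_smul]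
  · intro i j
    have e : KDQ d (a • F + b • H) i j = a • KDQ d F i j + b • KDQ d H i j := by
      unfold KDQ
      simp only [Matrix.add_apply, Matrix.smul_apply, add_mul, Finset.sum_add_distrib, mul_add,
        smul_mul_assoc, ← Finset.smul_sum, mul_smul_comm]
    rw [e]
    have := h3 i j
    have := k3 i j
    constructor
    · simp [*]
    · simp only [Complex.add_re, Complex.smul_re, smul_eq_mul]
      have := (h3 i j).2
      have := (k3 i j).2
      positivity

lemma main_sub {p : ℕ} (hp : p.Prime) (hd : n + 1 = p ^ 2) :
    KDplus (n + 1) ⊆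
      convexHull ℝ (setA (n + 1) ∪ setB (n + 1) ∪ setC2 (n + 1) p) := by
  rintro F ⟨h1, h2, h3⟩
  have hn : (0 : ℝ) < 1 / ((n + 1 : ℕ) : ℝ) := by positivity
  have hQ : ∀ i j : ZMod (n + 1), KDQ (n + 1) F i j
      = ((1 / ((n + 1 : ℕ) : ℝ) : ℝ) : ℂ) * qq (d := n + 1) F i j := by
    intro i j
    rw [KDQ_eq]
    push_cast
    rfl
  obtain ⟨α, β, γ, hα, hβ, hγ, hF⟩ := decomp (d := n + 1) hp hd F
    (fun i k => h1.1.apply k i)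
    (fun i j => by
      have := (h3 i j).1
      rw [hQ, Complex.im_ofReal_mul] at this
      exact (mul_eq_zero.1 this).resolve_left hn.ne')
    (fun i j => by
      have := (h3 i j).2
      rw [hQ, Complex.re_ofReal_mul] at this
      exact (mul_nonneg_iff_of_pos_left hn).1 this)
  let w : ZMod (n + 1) ⊕ ZMod (n + 1) ⊕ (Fin p × Fin p) → ℝ :=
    Sum.elim α (Sum.elim β (fun x => γ x.1 x.2))
  let z : ZMod (n + 1) ⊕ ZMod (n + 1) ⊕ (Fin p × Fin p) → Matrix (Fin (n + 1)) (Fin (n + 1)) ℂ :=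
    Sum.elim (fun i => proj (n + 1) (stdVec (n + 1) i))
      (Sum.elim (fun i => proj (n + 1) (fourierVec (n + 1) i))
        (fun x => proj (n + 1) (psiPQ (n + 1) p p x.1 x.2)))
  have hsum : F = ∑ x, w x • z x := by
    ext i k
    have := hF i k
    rw [this, Matrix.sum_apply]
    simp only [w, z, Fintype.sum_sum_type, Sum.elim_inl, Sum.elim_inr, Matrix.smul_apply,
      Complex.real_smul, Fintype.sum_prod_type, add_assoc]
    congr 1
    · exact Finset.sum_congr rfl fun x _ => congrArg _ (projA x i k).symm
    congr 1
    · exact Finset.sum_congr rfl fun x _ => congrArg _ (projB x i k).symm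
    · exact Finset.sum_congr rfl fun x _ => Finset.sum_congr rfl fun y _ => 
        congrArg _ (projC hp hd x y i k).symm
  have hz : ∀ x, (z x).trace = 1 := by
    rintro (i | j | ⟨m, s⟩)
    · exact (memA i).2.1
    · exact (memB j).2.1
    · exact (memC hp hd m s).2.1
  have hw : ∑ x, w x = 1 := by
    have h := h2
    rw [hsum, Matrix.trace_sum] at h
    simp only [Matrix.trace_smul, hz, Complex.real_smul, mul_one] at h
    exact_mod_cast h
  rw [hsum]
  refine (convex_convexHull ℝ _).sum_mem ?_ hw ?_
  · rintro (i | j | ⟨m, s⟩) _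
    · exact hα i
    · exact hβ j
    · exact hγ m s
  · intro x _
    apply subset_convexHull
    rcases x with (i | j | ⟨m, s⟩)
    · exact Or.inl (Or.inl ⟨i, rfl⟩)
    · exact Or.inl (Or.inr ⟨j, rfl⟩)
    · exact Or.inr ⟨m, s, rfl⟩

end bridge

end helpers

/-- For `d = p²` with `p` prime, `KD⁺ = ConvHull(A ∪ B ∪ C)`. -/
theorem stmt0 (p d : ℕ) (hp : p.Prime) (hd : d = p ^ 2) :
    KDplus d = convexHull ℝ (setA d ∪ setB d ∪ setC2 d p) := by
  obtain ⟨n, rfl⟩ : ∃ n, d = n + 1 :=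
    Nat.exists_eq_succ_of_ne_zero (by rw [hd]; exact pow_ne_zero _ hp.ne_zero)
  apply Set.Subset.antisymm (main_sub hp hd)
  apply convexHull_min _ (KDplus_convex _)
  rintro M ((⟨i, rfl⟩ | ⟨j, rfl⟩) | ⟨m, s, rfl⟩)
  · exact memA i
  · exact memB j
  · exact memC hp hd m s
end
end

section
/- Let d = p² with p prime. The real vector space KD^r of self-adjoint operators on ℂ^d whose KD distribution is everywhere real has dimension 3p² − 2p. -/
open Complex Matrix
open scoped ComplexOrder

noncomputable section

section KDhelpers

open ZMod

lemma kd_fv (n : ℕ) (i j : ZMod (n+1)) :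
    fourierVec (n+1) j i = ((1 / Real.sqrt ((n+1 : ℕ) : ℝ) : ℝ) : ℂ) * stdAddChar (i * j) := by
  have h : (i * j : ZMod (n+1)) = ((i.val * j.val : ℕ) : ℤ) := by
    push_cast
    simp
  rw [h, stdAddChar_coe]
  unfold fourierVec omega
  rw [← Complex.exp_nat_mul]
  congr 2
  have h1 : ∀ x : ZMod (n+1), Fin.val x = ZMod.val x := fun x => rfl
  rw [h1, h1]
  push_cast
  ring

lemma kd_conj_char (n : ℕ) (x : ZMod (n+1)) :
    (starRingEnd ℂ) (stdAddChar x) = stdAddChar (-x) := by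
  rw [AddChar.map_neg_eq_conj]

lemma kd_KDQ_eq (n : ℕ) (F : Matrix (ZMod (n+1)) (ZMod (n+1)) ℂ) (i j : ZMod (n+1)) :
    KDQ (n+1) F i j =
      (((1 / Real.sqrt ((n+1 : ℕ) : ℝ)) * (1 / Real.sqrt ((n+1 : ℕ) : ℝ)) : ℝ) : ℂ) *
        ZMod.dft (fun t => F i (i - t)) j := by
  have h0 : KDQ (n+1) F i j = (starRingEnd ℂ) (fourierVec (n+1) j i) *
    ∑ k : ZMod (n+1), F i k * fourierVec (n+1) j k := rfl
  rw [h0, ZMod.dft_apply, ← Equiv.sum_comp (Equiv.subLeft i), Finset.mul_sum, Finset.mul_sum]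
  refine Finset.sum_congr rfl fun t _ => ?_
  rw [kd_fv, kd_fv, map_mul, Complex.conj_ofReal, kd_conj_char]
  have : (-(t * j) : ZMod (n+1)) = -(i * j) + (i - t) * j := by ring
  rw [this, AddChar.map_add_eq_mul]
  simp only [Equiv.subLeft_apply, smul_eq_mul]
  push_cast
  ring

lemma kd_conj_dft (n : ℕ) (f : ZMod (n+1) → ℂ) (j : ZMod (n+1)) :
    (starRingEnd ℂ) (ZMod.dft f j) = ZMod.dft (fun t => (starRingEnd ℂ) (f (-t))) j := by
  rw [ZMod.dft_apply, ZMod.dft_apply, map_sum, ← Equiv.sum_comp (Equiv.neg _)]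
  refine Finset.sum_congr rfl fun t _ => ?_
  simp only [smul_eq_mul, map_mul, kd_conj_char, Equiv.neg_apply]
  congr 2
  ring

lemma kd_real_iff (n : ℕ) (F : Matrix (ZMod (n+1)) (ZMod (n+1)) ℂ) (i : ZMod (n+1)) :
    (∀ j : ZMod (n+1), (KDQ (n+1) F i j).im = 0) ↔
      ∀ t, F i (i - t) = (starRingEnd ℂ) (F i (i + t)) := by
  have hc : ((1 / Real.sqrt ((n+1 : ℕ) : ℝ)) * (1 / Real.sqrt ((n+1 : ℕ) : ℝ)) : ℝ) ≠ 0 := by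
    positivity
  have h1 : (∀ j : ZMod (n+1), (KDQ (n+1) F i j).im = 0) ↔
      ∀ j, ZMod.dft (fun t => (starRingEnd ℂ) (F i (i - -t))) j
        = ZMod.dft (fun t => F i (i - t)) j := by
    refine forall_congr' fun j => ?_
    rw [kd_KDQ_eq, Complex.im_ofReal_mul, mul_eq_zero, or_iff_right hc,
      ← Complex.conj_eq_iff_im, kd_conj_dft]
  rw [h1, ← funext_iff, ZMod.dft.injective.eq_iff, funext_iff]
  refine forall_congr' fun t => ?_
  rw [sub_neg_eq_add, eq_comm]

lemma kd_mem_iff (n : ℕ) (F : Matrix (ZMod (n+1)) (ZMod (n+1)) ℂ) :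
    F ∈ KDr (n+1) ↔ (∀ i k, (starRingEnd ℂ) (F k i) = F i k) ∧
      ∀ i t, F i (i - t) = (starRingEnd ℂ) (F i (i + t)) := by
  refine and_congr ?_ (forall_congr' fun i => kd_real_iff n F i)
  constructor
  · intro h i k
    exact h.apply i k
  · intro h
    exact Matrix.IsHermitian.ext h

/-- The index type: pairs of a step `t` and a coset of the subgroup generated by `t`. -/
abbrev KDIdx (n : ℕ) := Σ t : ZMod (n+1), ZMod (n+1) ⧸ AddSubgroup.zmultiples t

/-- The entries of the parametrization of `KD^r` by real functions on `KDIdx`. -/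
def kdE (n : ℕ) (r : KDIdx n → ℝ) (a b : ZMod (n+1)) : ℂ :=
  ⟨(r ⟨a - b, (b : ZMod (n+1))⟩ + r ⟨b - a, (b : ZMod (n+1))⟩) / 2,
    (r ⟨a - b, (b : ZMod (n+1))⟩ - r ⟨b - a, (b : ZMod (n+1))⟩) / 2⟩

lemma kdE_add (n : ℕ) (r s : KDIdx n → ℝ) (a b : ZMod (n+1)) :
    kdE n (r + s) a b = kdE n r a b + kdE n s a b := by
  apply Complex.ext
  · simp only [kdE, Complex.add_re, Pi.add_apply]
    ring
  · simp only [kdE, Complex.add_im, Pi.add_apply]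
    ring

lemma kdE_smul (n : ℕ) (c : ℝ) (r : KDIdx n → ℝ) (a b : ZMod (n+1)) :
    kdE n (c • r) a b = c • kdE n r a b := by
  apply Complex.ext
  · simp only [kdE, Complex.smul_re, Pi.smul_apply, smul_eq_mul]
    ring
  · simp only [kdE, Complex.smul_im, Pi.smul_apply, smul_eq_mul]
    ring

/-- The parametrization of `KD^r` by real functions on `KDIdx`. -/
def kdL (n : ℕ) : (KDIdx n → ℝ) →ₗ[ℝ] Matrix (Fin (n+1)) (Fin (n+1)) ℂ where
  toFun r := Matrix.of fun a b => kdE n r a b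
  map_add' r s := Matrix.ext fun a b => kdE_add n r s a b
  map_smul' c r := Matrix.ext fun a b => kdE_smul n c r a b

lemma kdL_apply (n : ℕ) (r : KDIdx n → ℝ) (a b : ZMod (n+1)) :
    kdL n r a b = ⟨(r ⟨a - b, (b : ZMod (n+1))⟩ + r ⟨b - a, (b : ZMod (n+1))⟩) / 2,
      (r ⟨a - b, (b : ZMod (n+1))⟩ - r ⟨b - a, (b : ZMod (n+1))⟩) / 2⟩ := rfl

lemma kd_idx (n : ℕ) (t t' b b' : ZMod (n+1)) (ht : t = t')
    (h : b' - b ∈ AddSubgroup.zmultiples t) :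
    (⟨t, (b : ZMod (n+1))⟩ : KDIdx n) = ⟨t', (b' : ZMod (n+1))⟩ := by
  subst ht
  congr 1
  rw [QuotientAddGroup.eq]
  rwa [neg_add_eq_sub]

lemma kdL_inj (n : ℕ) : Function.Injective (kdL n) := by
  intro r s h
  funext ⟨t, q⟩
  induction q using QuotientAddGroup.induction_on with
  | H b =>
    have h1 : kdL n r (b + t : ZMod (n+1)) b = kdL n s (b + t : ZMod (n+1)) b := by rw [h]
    rw [kdL_apply, kdL_apply, Complex.ext_iff] at h1
    obtain ⟨h1, h2⟩ := h1
    dsimp only at h1 h2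
    have e : (⟨b + t - b, (b : ZMod (n+1))⟩ : KDIdx n) = ⟨t, (b : ZMod (n+1))⟩ :=
      kd_idx n _ _ _ _ (by ring) (by simp)
    rw [e] at h1 h2
    linarith

lemma kdL_mem (n : ℕ) (r : KDIdx n → ℝ) : kdL n r ∈ KDr (n+1) := by
  refine (kd_mem_iff n _).2 ⟨fun i k => ?_, fun i t => ?_⟩
  · have e1 : (⟨i - k, (k : ZMod (n+1))⟩ : KDIdx n) = ⟨i - k, (i : ZMod (n+1))⟩ :=
      kd_idx n _ _ _ _ rfl ⟨1, by simp⟩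
    have e2 : (⟨k - i, (k : ZMod (n+1))⟩ : KDIdx n) = ⟨k - i, (i : ZMod (n+1))⟩ :=
      kd_idx n _ _ _ _ rfl ⟨-1, by simp⟩
    rw [kdL_apply, kdL_apply, e1, e2]
    apply Complex.ext
    · simp only [Complex.conj_re]
      ring
    · simp only [Complex.conj_im]
      ring
  · have e1 : (⟨i - (i - t), ((i - t : ZMod (n+1)) : ZMod (n+1) ⧸ _)⟩ : KDIdx n)
        = ⟨t, (i : ZMod (n+1))⟩ :=
      kd_idx n _ _ _ _ (by ring) ⟨1, by simp⟩
    have e2 : (⟨(i - t) - i, ((i - t : ZMod (n+1)) : ZMod (n+1) ⧸ _)⟩ : KDIdx n)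
        = ⟨-t, (i : ZMod (n+1))⟩ :=
      kd_idx n _ _ _ _ (by ring) ⟨-1, by simp⟩
    have e3 : (⟨i - (i + t), ((i + t : ZMod (n+1)) : ZMod (n+1) ⧸ _)⟩ : KDIdx n)
        = ⟨-t, (i : ZMod (n+1))⟩ :=
      kd_idx n _ _ _ _ (by ring) ⟨1, by simp⟩
    have e4 : (⟨(i + t) - i, ((i + t : ZMod (n+1)) : ZMod (n+1) ⧸ _)⟩ : KDIdx n)
        = ⟨t, (i : ZMod (n+1))⟩ :=
      kd_idx n _ _ _ _ (by ring) ⟨-1, by simp⟩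
    rw [kdL_apply, kdL_apply, e1, e2, e3, e4]
    apply Complex.ext
    · simp only [Complex.conj_re]
      ring
    · simp only [Complex.conj_im]
      ring

lemma kd_invariant (n : ℕ) (F : Matrix (ZMod (n+1)) (ZMod (n+1)) ℂ)
    (hF : ∀ t b, F (b + t) b = F b (b - t)) (t b b' : ZMod (n+1))
    (h : b' - b ∈ AddSubgroup.zmultiples t) : F (b' + t) b' = F (b + t) b := by
  obtain ⟨m, hm⟩ := h
  have hb : b' = b + m • t := by
    rw [show m • t = b' - b from hm]; ring
  have key : ∀ (m : ℕ) (b : ZMod (n+1)), F (b + m • t + t) (b + m • t) = F (b + t) b := by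
    intro m
    induction m with
    | zero => intro b; simp
    | succ m ih =>
      intro b
      rw [← ih b, hF, succ_nsmul]
      congr 1 <;> ring
  subst hb
  obtain ⟨k, rfl | rfl⟩ := m.eq_nat_or_neg
  · rw [natCast_zsmul]
    exact key k b
  · have := key k (b + (-(k : ℤ)) • t)
    rw [← this]
    simp

lemma kdL_surj (n : ℕ) (F : Matrix (ZMod (n+1)) (ZMod (n+1)) ℂ) (hF : F ∈ KDr (n+1)) :
    ∃ r, kdL n r = F := by
  obtain ⟨h1, h2⟩ := (kd_mem_iff n F).1 hF
  have h3 : ∀ t b, F (b + t) b = F b (b - t) := by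
    intro t b
    rw [h2, h1]
  have hinv := kd_invariant n F h3
  have hr : ∀ t b : ZMod (n+1),
      F ((b : ZMod (n+1) ⧸ AddSubgroup.zmultiples t).out + t)
        ((b : ZMod (n+1) ⧸ AddSubgroup.zmultiples t).out) = F (b + t) b := by
    intro t b
    apply hinv
    have := QuotientAddGroup.out_eq' (b : ZMod (n+1) ⧸ AddSubgroup.zmultiples t)
    have := QuotientAddGroup.eq.1 this.symm
    rwa [neg_add_eq_sub] at this
  refine ⟨fun x => (F (x.2.out + x.1) x.2.out).re + (F (x.2.out + x.1) x.2.out).im, ?_⟩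
  refine Matrix.ext fun (a b : ZMod (n+1)) => ?_
  rw [kdL_apply]
  dsimp only
  rw [hr, hr]
  have e1 : b + (a - b) = a := by ring
  have e2 : b + (b - a) = b - (a - b) := by ring
  have e3 : F (b - (a - b)) b = (starRingEnd ℂ) (F a b) := by
    rw [← h1, ← h3, e1]
  rw [e1, e2, e3]
  apply Complex.ext
  · simp only [Complex.conj_re, Complex.conj_im]
    ring
  · simp only [Complex.conj_re, Complex.conj_im]
    ring

lemma kd_finrank (n : ℕ) :
    Module.finrank ℝ (Submodule.span ℝ (KDr (n+1))) = Nat.card (KDIdx n) := by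
  have h : KDr (n+1) = (LinearMap.range (kdL n) : Set (Matrix (Fin (n+1)) (Fin (n+1)) ℂ)) := by
    ext F
    constructor
    · intro hF
      exact kdL_surj n F hF
    · rintro ⟨r, rfl⟩
      exact kdL_mem n r
  classical
  haveI : Fintype (KDIdx n) := Fintype.ofFinite _
  rw [h, Submodule.span_eq, LinearMap.finrank_range_of_inj (kdL_inj n), Module.finrank_pi,
    Nat.card_eq_fintype_card]

lemma kd_index (n : ℕ) (t : ZMod (n+1)) :
    Nat.card (ZMod (n+1) ⧸ AddSubgroup.zmultiples t) = (n+1).gcd t.val := by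
  have h := AddSubgroup.index_mul_card (AddSubgroup.zmultiples t)
  rw [Nat.card_zmultiples, Nat.card_zmod] at h
  have h2 : addOrderOf t = (n+1) / (n+1).gcd t.val := by
    conv_lhs => rw [← ZMod.natCast_zmod_val t]
    exact ZMod.addOrderOf_coe _ (Nat.succ_ne_zero n)
  rw [h2] at h
  have h3 : (n+1).gcd t.val * ((n+1) / (n+1).gcd t.val) = n+1 :=
    Nat.mul_div_cancel' (Nat.gcd_dvd_left _ _)
  have h4 : 0 < (n+1) / (n+1).gcd t.val := by
    rcases Nat.eq_zero_or_pos ((n+1) / (n+1).gcd t.val) with h5 | h5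
    · rw [h5] at h3; omega
    · exact h5
  exact Nat.eq_of_mul_eq_mul_right h4 (h.trans h3.symm)

lemma kd_card (n : ℕ) : Nat.card (KDIdx n) = ∑ k ∈ Finset.range (n+1), (n+1).gcd k := by
  rw [Nat.card_sigma, Finset.sum_range]
  exact Finset.sum_congr rfl fun t _ => kd_index n t

lemma kd_pillai (d : ℕ) (hd : d ≠ 0) :
    ∑ k ∈ Finset.range d, d.gcd k = ∑ g ∈ d.divisors, Nat.totient (d / g) * g := by
  rw [← Finset.sum_fiberwise_of_maps_to (s := Finset.range d) (t := d.divisors)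
    (g := fun k => d.gcd k) (fun k _ => Nat.mem_divisors.2 ⟨Nat.gcd_dvd_left _ _, hd⟩)]
  refine Finset.sum_congr rfl fun g hg => ?_
  rw [Nat.totient_div_of_dvd (Nat.dvd_of_mem_divisors hg), Finset.sum_congr rfl
    (fun x hx => (Finset.mem_filter.1 hx).2), Finset.sum_const, smul_eq_mul]

end KDhelpers

/-- For `d = p²` with `p` prime, the real vector space `KD^r`
has dimension `3p² − 2p`. -/
theorem stmt6 (p d : ℕ) (hp : p.Prime) (hd : d = p ^ 2) :
    Module.finrank ℝ (Submodule.span ℝ (KDr d)) = 3 * p ^ 2 - 2 * p := by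
  subst hd
  have hp0 : 0 < p := hp.pos
  have hd0 : p ^ 2 ≠ 0 := by positivity
  have h : Module.finrank ℝ (Submodule.span ℝ (KDr (p ^ 2)))
      = ∑ k ∈ Finset.range (p ^ 2), (p ^ 2).gcd k := by
    obtain ⟨n, hn⟩ := Nat.exists_eq_succ_of_ne_zero hd0
    rw [hn]
    exact (kd_finrank n).trans (kd_card n)
  rw [h, kd_pillai _ hd0, Nat.sum_divisors_prime_pow hp]
  have e1 : p ^ 2 / p ^ 1 = p := by rw [pow_one, sq, Nat.mul_div_cancel _ hp0]
  have e2 : p ^ 2 / p ^ 2 = 1 := Nat.div_self (Nat.pos_of_ne_zero hd0)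
  have e0 : p ^ 2 / p ^ 0 = p ^ 2 := by simp
  rw [Finset.sum_range_succ, Finset.sum_range_succ, Finset.sum_range_one, e0, e1, e2,
    Nat.totient_one, Nat.totient_prime hp, Nat.totient_prime_pow hp two_pos]
  obtain ⟨q, rfl⟩ := Nat.exists_eq_succ_of_ne_zero hp0.ne'
  simp only [Nat.succ_eq_add_one, Nat.add_sub_cancel]
  symm
  apply Nat.sub_eq_of_eq_add
  simp only [Nat.add_one_sub_one, pow_one, pow_zero]
  ring
end
end

section
/- Let d = pq with p, q distinct primes, and let X, Y, Z be any three pairwise distinct sets chosen from the four sets A, B, C, D. Then the real span of X ∪ Y ∪ Z inside the real vector space of self-adjoint d×d complex matrices has dimension 3pq − p − q. -/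
open Complex Matrix
open scoped ComplexOrder

noncomputable section

/-! ### Real versus complex dimension -/

lemma finrank_real_eq_complex {d : ℕ} (S : Set (Matrix (Fin d) (Fin d) ℂ))
    (hS : ∀ M ∈ S, M.IsHermitian) :
    Module.finrank ℝ (Submodule.span ℝ S) = Module.finrank ℂ (Submodule.span ℂ S) := by
  obtain ⟨b, hbS, hspan, hli⟩ := exists_linearIndependent ℝ S
  have hfin : b.Finite := hli.setFinite
  have : Fintype b := hfin.fintype
  have hliC : LinearIndependent ℂ (Subtype.val : b → Matrix (Fin d) (Fin d) ℂ) := by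
    rw [Fintype.linearIndependent_iff] at hli ⊢
    intro g hg
    have hg2 : ∑ i, (starRingEnd ℂ) (g i) • (i : Matrix (Fin d) (Fin d) ℂ) = 0 := by
      have h := congrArg Matrix.conjTranspose hg
      rw [Matrix.conjTranspose_sum, Matrix.conjTranspose_zero] at h
      rw [← h]
      refine Finset.sum_congr rfl fun i _ => ?_
      rw [Matrix.conjTranspose_smul, (hS _ (hbS i.2)).eq]
      rfl
    have hre : ∑ i, (g i).re • (i : Matrix (Fin d) (Fin d) ℂ) = 0 := by
      ext r c
      have h1 := congrFun (congrFun hg r) c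
      have h2 := congrFun (congrFun hg2 r) c
      simp only [Matrix.sum_apply, Matrix.smul_apply, smul_eq_mul, Matrix.zero_apply,
        Complex.real_smul] at h1 h2 ⊢
      have h3 : ∑ i : b, (((g i).re : ℝ) : ℂ) * (i : Matrix (Fin d) (Fin d) ℂ) r c =
          (∑ i : b, g i * (i : Matrix (Fin d) (Fin d) ℂ) r c +
          ∑ i : b, (starRingEnd ℂ) (g i) * (i : Matrix (Fin d) (Fin d) ℂ) r c) / 2 := by
        rw [← Finset.sum_add_distrib, Finset.sum_div]
        refine Finset.sum_congr rfl fun i _ => ?_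
        rw [Complex.re_eq_add_conj]; ring
      rw [h3, h1, h2]; simp
    have him : ∑ i, (g i).im • (i : Matrix (Fin d) (Fin d) ℂ) = 0 := by
      ext r c
      have h1 := congrFun (congrFun hg r) c
      have h2 := congrFun (congrFun hg2 r) c
      simp only [Matrix.sum_apply, Matrix.smul_apply, smul_eq_mul, Matrix.zero_apply,
        Complex.real_smul] at h1 h2 ⊢
      have h3 : ∑ i : b, (((g i).im : ℝ) : ℂ) * (i : Matrix (Fin d) (Fin d) ℂ) r c =
          (∑ i : b, g i * (i : Matrix (Fin d) (Fin d) ℂ) r c -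
          ∑ i : b, (starRingEnd ℂ) (g i) * (i : Matrix (Fin d) (Fin d) ℂ) r c) / (2 * I) := by
        rw [← Finset.sum_sub_distrib, Finset.sum_div]
        refine Finset.sum_congr rfl fun i _ => ?_
        rw [Complex.im_eq_sub_conj]; ring
      rw [h3, h1, h2]; simp
    intro i
    exact Complex.ext (hli _ hre i) (hli _ him i)
  have hspanC : Submodule.span ℂ b = Submodule.span ℂ S := by
    rw [← Submodule.span_span_of_tower ℝ ℂ b, hspan, Submodule.span_span_of_tower]
  rw [← hspan, ← hspanC]
  have h1 := finrank_span_eq_card hli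
  have h2 := finrank_span_eq_card hliC
  rw [Subtype.range_coe] at h1 h2
  rw [h1, h2]

lemma proj_isHermitian (d : ℕ) (v : Fin d → ℂ) : (proj d v).IsHermitian := by
  ext i k
  simp [proj, Matrix.conjTranspose_apply, mul_comm]

/-! ### Roots of unity -/

lemma omega_prim {n : ℕ} (hn : n ≠ 0) : IsPrimitiveRoot (omega n) n :=
  Complex.isPrimitiveRoot_exp n hn

lemma omega_mul_conj (n : ℕ) : omega n * (starRingEnd ℂ) (omega n) = 1 := by
  have h : omega n = Complex.exp (((2 * Real.pi / n : ℝ) : ℂ) * I) := by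
    unfold omega; congr 1; push_cast; ring
  rw [h, ← Complex.exp_conj, ← Complex.exp_add, map_mul, Complex.conj_ofReal, Complex.conj_I,
    mul_neg, add_neg_cancel, Complex.exp_zero]

lemma omega_pow_mul_right {p q : ℕ} (hq : q ≠ 0) : omega (p * q) ^ q = omega p := by
  unfold omega
  rw [← Complex.exp_nat_mul]
  congr 1
  have : (q : ℂ) ≠ 0 := by exact_mod_cast hq
  push_cast
  by_cases hp : (p : ℂ) = 0
  · simp [hp]
  · field_simp

lemma omega_pow_mod {n : ℕ} (hn : n ≠ 0) (a : ℕ) : omega n ^ (a % n) = omega n ^ a :=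
  (pow_eq_pow_mod a (omega_prim hn).pow_eq_one).symm

lemma orth {n : ℕ} (hn : n ≠ 0) (a b : ℕ) :
    ∑ j : Fin n, omega n ^ (a * j.val) * (starRingEnd ℂ) (omega n) ^ (b * j.val) =
      if a ≡ b [MOD n] then (n : ℂ) else 0 := by
  have hz := omega_prim hn
  set w := omega n
  set c := (starRingEnd ℂ) w
  have hwc : w * c = 1 := omega_mul_conj n
  have hc0 : c ≠ 0 := right_ne_zero_of_mul_eq_one hwc
  have hw0 : w ≠ 0 := left_ne_zero_of_mul_eq_one hwc
  have hcn : c ^ n = 1 := by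
    have : (w * c) ^ n = 1 := by rw [hwc, one_pow]
    rwa [mul_pow, hz.pow_eq_one, one_mul] at this
  have hwb : w ^ b * c ^ b = 1 := by rw [← mul_pow, hwc, one_pow]
  have hsum : ∑ j : Fin n, w ^ (a * j.val) * c ^ (b * j.val) =
      ∑ j ∈ Finset.range n, (w ^ a * c ^ b) ^ j := by
    rw [Finset.sum_range]
    refine Finset.sum_congr rfl fun j _ => ?_
    rw [mul_pow, pow_mul, pow_mul]
  rw [hsum]
  have key : w ^ a * c ^ b = 1 ↔ a ≡ b [MOD n] := by
    have hmod : a ≡ b [MOD n] ↔ w ^ a = w ^ b := by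
      rw [hz.eq_orderOf]; exact (isOfFinOrder_iff_pow_eq_one.2
        ⟨n, Nat.pos_of_ne_zero hn, hz.pow_eq_one⟩).pow_eq_pow_iff_modEq.symm
    rw [hmod]
    constructor
    · intro h
      calc w ^ a = w ^ a * (w ^ b * c ^ b) := by rw [hwb, mul_one]
        _ = w ^ b * (w ^ a * c ^ b) := by ring
        _ = w ^ b := by rw [h, mul_one]
    · intro h; rw [h, hwb]
  split_ifs with h
  · rw [key.2 h]; simp
  · have hx : w ^ a * c ^ b ≠ 1 := fun h' => h (key.1 h')
    rw [geom_sum_eq hx]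
    have : (w ^ a * c ^ b) ^ n = 1 := by
      rw [mul_pow, ← pow_mul, ← pow_mul, mul_comm a, mul_comm b, pow_mul, pow_mul,
        hz.pow_eq_one, hcn]; simp
    rw [this]; simp

/-! ### Weyl operators -/

/-- Weyl operators. -/
def Weyl (d : ℕ) (g : Fin d × Fin d) : Matrix (Fin d) (Fin d) ℂ :=
  Matrix.of fun i k => if i.val ≡ k.val + g.1.val [MOD d] then omega d ^ (g.2.val * k.val) else 0

lemma weyl_li {d : ℕ} (hd : d ≠ 0) : LinearIndependent ℂ (Weyl d) := by
  rw [Fintype.linearIndependent_iff]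
  intro g hg
  have hz := omega_prim hd
  have main : ∀ t : Fin d, (fun u => g (t, u)) = 0 := by
    intro t
    refine Matrix.eq_zero_of_forall_index_sum_pow_mul_eq_zero
      (f := fun k : Fin d => omega d ^ k.val) ?_ ?_
    · intro k l hkl
      exact Fin.ext (hz.pow_inj k.2 l.2 hkl)
    · intro k
      have h := congrFun (congrFun hg ⟨(k.val + t.val) % d, Nat.mod_lt _ (Nat.pos_of_ne_zero hd)⟩) k
      simp only [Matrix.sum_apply, Matrix.smul_apply, smul_eq_mul, Matrix.zero_apply, Weyl,
        Matrix.of_apply] at h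
      rw [Fintype.sum_prod_type, Finset.sum_eq_single t] at h
      · rw [← h]
        refine Finset.sum_congr rfl fun u _ => ?_
        rw [if_pos (Nat.mod_modEq _ _), ← pow_mul, mul_comm k.val, mul_comm]
      · intro s _ hst
        refine Finset.sum_eq_zero fun u _ => ?_
        rw [if_neg, mul_zero]
        intro h'
        have h2 : k.val + t.val ≡ k.val + s.val [MOD d] := (Nat.mod_modEq _ _).symm.trans h'
        have h3 := Nat.ModEq.add_left_cancel' _ h2
        exact hst (Fin.ext (Nat.ModEq.eq_of_lt_of_lt h3 t.2 s.2).symm)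
      · simp
  rintro ⟨t, u⟩
  exact congrFun (main t) u

/-- Multiples of `a` in `Fin d`. -/
def Mul' (d a : ℕ) : Finset (Fin d) := Finset.univ.filter fun u => a ∣ u.val

lemma card_Mul {d a b : ℕ} (h : d = a * b) (ha : a ≠ 0) : (Mul' d a).card = b := by
  have : Mul' d a = Finset.univ.image
      (fun j : Fin b => (⟨a * j.val, h ▸ Nat.mul_lt_mul_of_pos_left j.2 (Nat.pos_of_ne_zero ha)⟩ : Fin d)) := by
    ext u
    simp only [Mul', Finset.mem_filter, Finset.mem_univ, true_and, Finset.mem_image]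
    constructor
    · rintro ⟨c, hc⟩
      have hu := u.2
      rw [hc, h] at hu
      exact ⟨⟨c, Nat.lt_of_mul_lt_mul_left hu⟩, Fin.ext hc.symm⟩
    · rintro ⟨j, rfl⟩
      exact Dvd.intro _ rfl
  rw [this, Finset.card_image_of_injective, Finset.card_univ, Fintype.card_fin]
  intro x y hxy
  have := congrArg Fin.val hxy
  exact Fin.ext (Nat.eq_of_mul_eq_mul_left (Nat.pos_of_ne_zero ha) this)

/-- Rectangles of indices. -/
def Rect (d a b : ℕ) : Finset (Fin d × Fin d) := Mul' d a ×ˢ Mul' d b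

lemma Rect_inter (d a b a' b' : ℕ) :
    Rect d a b ∩ Rect d a' b' = Rect d (Nat.lcm a a') (Nat.lcm b b') := by
  ext ⟨t, u⟩
  simp only [Rect, Mul', Finset.mem_inter, Finset.mem_product, Finset.mem_filter,
    Finset.mem_univ, true_and, Nat.lcm_dvd_iff]
  tauto

lemma card_Rect {d a b a' b' : ℕ} (h : d = a * a') (h' : d = b * b') (ha : a ≠ 0) (hb : b ≠ 0) :
    (Rect d a b).card = a' * b' := by
  rw [Rect, Finset.card_product, card_Mul h ha, card_Mul h' hb]

lemma finrank_weyl {d : ℕ} (hd : d ≠ 0) (F : Finset (Fin d × Fin d)) :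
    Module.finrank ℂ (Submodule.span ℂ (Weyl d '' (F : Set (Fin d × Fin d)))) = F.card := by
  have h := finrank_span_eq_card ((weyl_li hd).comp (Subtype.val : F → _) Subtype.val_injective)
  rw [Set.range_comp, Fintype.card_coe] at h
  rw [← h, Subtype.range_coe_subtype]
  rfl

lemma span_eq_weyl {d : ℕ} (hd : d ≠ 0) {ι : Type} [Fintype ι] (P : ι → Matrix (Fin d) (Fin d) ℂ)
    (F : Finset (Fin d × Fin d)) (hcard : Fintype.card ι ≤ F.card)
    (h : ∀ g ∈ F, ∃ c : ι → ℂ, Weyl d g = ∑ x, c x • P x) :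
    Submodule.span ℂ (Set.range P) = Submodule.span ℂ (Weyl d '' (F : Set (Fin d × Fin d))) := by
  symm
  apply Submodule.eq_of_le_of_finrank_le
  · rw [Submodule.span_le]
    rintro _ ⟨g, hg, rfl⟩
    obtain ⟨c, hc⟩ := h g hg
    rw [hc]
    exact Submodule.sum_mem _ fun x _ =>
      Submodule.smul_mem _ _ (Submodule.subset_span ⟨x, rfl⟩)
  · rw [finrank_weyl hd]
    exact (finrank_range_le_card P).trans hcard

lemma sqrt_fac {n : ℕ} : ((1 / Real.sqrt n : ℝ) : ℂ) * ((1 / Real.sqrt n : ℝ) : ℂ) = 1 / n := by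
  rw [← Complex.ofReal_mul]
  have : (1 / Real.sqrt n) * (1 / Real.sqrt n) = 1 / (n : ℝ) := by
    rw [div_mul_div_comm, Real.mul_self_sqrt (Nat.cast_nonneg n), one_mul]
  rw [this]; push_cast; rfl

lemma spanA {d : ℕ} (hd : d ≠ 0) :
    Submodule.span ℂ (setA d) =
      Submodule.span ℂ (Weyl d '' (Rect d d 1 : Set (Fin d × Fin d))) := by
  have : setA d = Set.range fun i => proj d (stdVec d i) := by
    ext M; simp [setA, eq_comm]
  rw [this]
  apply span_eq_weyl hd
  · rw [card_Rect (mul_one d).symm (one_mul d).symm hd one_ne_zero]; simp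
  · rintro ⟨t, u⟩ hg
    have ht : d ∣ t.val := by simpa [Rect, Mul'] using hg
    have ht0 : t.val = 0 := Nat.eq_zero_of_dvd_of_lt ht t.2
    refine ⟨fun j => omega d ^ (u.val * j.val), ?_⟩
    ext i k
    simp only [Weyl, Matrix.sum_apply, Matrix.smul_apply, smul_eq_mul, Matrix.of_apply, proj,
      stdVec, ht0, add_zero]
    rw [Finset.sum_eq_single k]
    · have : (i.val ≡ k.val [MOD d]) ↔ i = k :=
        ⟨fun h => Fin.ext (Nat.ModEq.eq_of_lt_of_lt h i.2 k.2), fun h => by rw [h]⟩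
      simp [this]
    · intro j _ hj
      simp [hj.symm]
    · simp

lemma spanB {d : ℕ} (hd : d ≠ 0) :
    Submodule.span ℂ (setB d) =
      Submodule.span ℂ (Weyl d '' (Rect d 1 d : Set (Fin d × Fin d))) := by
  have : setB d = Set.range fun i => proj d (fourierVec d i) := by
    ext M; simp [setB, eq_comm]
  rw [this]
  apply span_eq_weyl hd
  · rw [card_Rect (one_mul d).symm (mul_one d).symm one_ne_zero hd]; simp
  · rintro ⟨t, u⟩ hg
    have ht : d ∣ u.val := by simpa [Rect, Mul'] using hg
    have hu0 : u.val = 0 := Nat.eq_zero_of_dvd_of_lt ht u.2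
    refine ⟨fun j => (starRingEnd ℂ) (omega d) ^ (t.val * j.val), ?_⟩
    ext i k
    simp only [Weyl, Matrix.sum_apply, Matrix.smul_apply, smul_eq_mul, Matrix.of_apply, proj,
      fourierVec, hu0, zero_mul, pow_zero, map_mul, map_pow, Complex.conj_ofReal]
    have hd' : (d : ℂ) ≠ 0 := by exact_mod_cast hd
    have h := orth hd i.val (k.val + t.val)
    calc _ = (1 / (d : ℂ)) * (if i.val ≡ k.val + t.val [MOD d] then (d : ℂ) else 0) := by
          split_ifs <;> simp [hd']
      _ = _ := by
          rw [← h, Finset.mul_sum, ← sqrt_fac]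
          refine Finset.sum_congr rfl fun j _ => ?_
          rw [add_mul, pow_add]; ring

lemma modEq_split {p q i k a : ℕ} (hp : p ≠ 0) :
    i ≡ k + p * a [MOD p * q] ↔ i % p = k % p ∧ i / p ≡ k / p + a [MOD q] := by
  have hi := Nat.div_add_mod i p
  have hk := Nat.div_add_mod k p
  constructor
  · intro h
    have h1 : i % p = k % p := by
      have := h.of_mul_right q
      simpa [Nat.ModEq] using this
    refine ⟨h1, ?_⟩
    rw [← hi, ← hk, h1, add_right_comm, ← mul_add] at h
    have h2 := Nat.ModEq.add_right_cancel' _ h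
    exact Nat.ModEq.mul_left_cancel' hp h2
  · rintro ⟨h1, h2⟩
    have h3 := (Nat.ModEq.mul_left' p h2).add_right (k % p)
    rw [← h1, hi, h1, mul_add, add_right_comm, hk] at h3
    exact h3

lemma spanC {d p q : ℕ} (hp : p ≠ 0) (hq : q ≠ 0) (hd : d = p * q) :
    Submodule.span ℂ (setC d p q) =
      Submodule.span ℂ (Weyl d '' (Rect d p q : Set (Fin d × Fin d))) := by
  have : setC d p q = Set.range fun x : Fin p × Fin q => proj d (psiPQ d p q x.1 x.2) := by
    ext M; simp [setC, eq_comm]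
  rw [this]
  apply span_eq_weyl (by rw [hd]; exact mul_ne_zero hp hq)
  · rw [card_Rect hd (by rw [hd, mul_comm]) hp hq]; simp [mul_comm]
  · rintro ⟨t, u⟩ hg
    have ht : p ∣ t.val ∧ q ∣ u.val := by simpa [Rect, Mul'] using hg
    obtain ⟨⟨a, ha⟩, ⟨b, hb⟩⟩ := ht
    refine ⟨fun x => omega p ^ (b * x.1.val) * (starRingEnd ℂ) (omega q) ^ (a * x.2.val), ?_⟩
    ext i k
    simp only [Weyl, Matrix.sum_apply, Matrix.smul_apply, smul_eq_mul, Matrix.of_apply, proj,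
      psiPQ, ha, hb]
    rw [Fintype.sum_prod_type,
      Finset.sum_eq_single ⟨k.val % p, Nat.mod_lt _ (Nat.pos_of_ne_zero hp)⟩]
    · simp only [if_true]
      have hw : omega d ^ (q * b * k.val) = omega p ^ (b * (k.val % p)) := by
        have hdq : omega d ^ q = omega p := by rw [hd]; exact omega_pow_mul_right hq
        rw [mul_assoc, pow_mul, hdq, mul_comm b, mul_comm b, pow_mul,
          pow_mul, omega_pow_mod hp]
      rw [hw]
      have hq' : (q : ℂ) ≠ 0 := by exact_mod_cast hq
      have h := orth hq (i.val / p) (k.val / p + a)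
      have hms : (i.val ≡ k.val + p * a [MOD d]) ↔
          i.val % p = k.val % p ∧ i.val / p ≡ k.val / p + a [MOD q] := by
        have hm := modEq_split (q := q) (i := i.val) (k := k.val) (a := a) hp
        rwa [← hd] at hm
      by_cases hik : i.val % p = k.val % p
      · simp only [hik, true_and] at hms
        simp only [hik, if_true, hms, map_mul, map_pow, Complex.conj_ofReal]
        calc _ = omega p ^ (b * (k.val % p)) * ((1 / (q : ℂ)) *
              (if i.val / p ≡ k.val / p + a [MOD q] then (q : ℂ) else 0)) := by
              split_ifs <;> simp [hq']
          _ = _ := by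
              rw [← h, Finset.mul_sum, Finset.mul_sum, ← sqrt_fac]
              refine Finset.sum_congr rfl fun j _ => ?_
              rw [add_mul, pow_add, mul_comm (i.val / p), mul_comm (k.val / p)]; ring
      · simp [hms, hik]
    · intro m _ hm
      refine Finset.sum_eq_zero fun s _ => ?_
      have : ¬ k.val % p = m.val := fun h => hm (Fin.ext h.symm)
      simp [this]
    · simp

lemma spanD {d p q : ℕ} (hp : p ≠ 0) (hq : q ≠ 0) (hd : d = p * q) :
    Submodule.span ℂ (setD d p q) =
      Submodule.span ℂ (Weyl d '' (Rect d q p : Set (Fin d × Fin d))) :=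
  spanC hq hp (by rw [hd, mul_comm])

/-- The four sets. -/
def fam (d p q : ℕ) : Fin 4 → Set (Matrix (Fin d) (Fin d) ℂ) :=
  ![setA d, setB d, setC d p q, setD d p q]

/-- The first coordinate of the index rectangles. -/
def e1 (d p q : ℕ) : Fin 4 → ℕ := ![d, 1, p, q]

/-- The second coordinate of the index rectangles. -/
def e2 (d p q : ℕ) : Fin 4 → ℕ := ![1, d, q, p]

lemma span_fam {d p q : ℕ} (hp : p ≠ 0) (hq : q ≠ 0) (hd : d = p * q) (x : Fin 4) :
    Submodule.span ℂ (fam d p q x) =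
      Submodule.span ℂ (Weyl d '' (Rect d (e1 d p q x) (e2 d p q x) : Set (Fin d × Fin d))) := by
  have hd0 : d ≠ 0 := by rw [hd]; exact mul_ne_zero hp hq
  fin_cases x
  · exact spanA hd0
  · exact spanB hd0
  · exact spanC hp hq hd
  · exact spanD hp hq hd

lemma herm_fam {d p q : ℕ} (x : Fin 4) : ∀ M ∈ fam d p q x, M.IsHermitian := by
  fin_cases x
  · rintro _ ⟨_, rfl⟩; exact proj_isHermitian _ _
  · rintro _ ⟨_, rfl⟩; exact proj_isHermitian _ _
  · rintro _ ⟨_, _, rfl⟩; exact proj_isHermitian _ _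
  · rintro _ ⟨_, _, rfl⟩; exact proj_isHermitian _ _

lemma mem_fam {d p q : ℕ} {X : Set (Matrix (Fin d) (Fin d) ℂ)}
    (hX : X ∈ ({setA d, setB d, setC d p q, setD d p q} :
      Set (Set (Matrix (Fin d) (Fin d) ℂ)))) : ∃ x, X = fam d p q x := by
  rcases hX with rfl | rfl | rfl | rfl
  exacts [⟨0, rfl⟩, ⟨1, rfl⟩, ⟨2, rfl⟩, ⟨3, rfl⟩]

lemma card_three {α : Type*} [DecidableEq α] (s t u : Finset α) :
    (s ∪ t ∪ u).card + (s ∩ t).card + (s ∩ u).card + (t ∩ u).card =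
      s.card + t.card + u.card + (s ∩ t ∩ u).card := by
  have h1 := Finset.card_union_add_card_inter (s ∪ t) u
  have h2 := Finset.card_union_add_card_inter s t
  have h3 := Finset.card_union_add_card_inter (s ∩ u) (t ∩ u)
  rw [← Finset.union_inter_distrib_right] at h3
  have h4 : s ∩ u ∩ (t ∩ u) = s ∩ t ∩ u := by grind
  rw [h4] at h3
  omega

set_option maxHeartbeats 4000000 in
lemma count {p q d : ℕ} (hp : p.Prime) (hq : q.Prime) (hpq : p ≠ q)
    (hd : d = p * q) (x y z : Fin 4) (hxy : x ≠ y) (hxz : x ≠ z) (hyz : y ≠ z) :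
    (Rect d (e1 d p q x) (e2 d p q x) ∪ Rect d (e1 d p q y) (e2 d p q y) ∪
      Rect d (e1 d p q z) (e2 d p q z)).card = 3 * p * q - p - q := by
  have hc : Nat.Coprime p q := (Nat.coprime_primes hp hq).2 hpq
  have hp0 := hp.ne_zero
  have hq0 := hq.ne_zero
  have hd0 : d ≠ 0 := by rw [hd]; exact mul_ne_zero hp0 hq0
  have hd' : d = q * p := by rw [hd, mul_comm]
  have l1 : Nat.lcm p q = d := by rw [hc.lcm_eq_mul, hd]
  have l2 : Nat.lcm q p = d := by rw [Nat.lcm_comm, l1]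
  have hpd : p ∣ d := ⟨q, hd⟩
  have hqd : q ∣ d := ⟨p, hd'⟩
  have l3 : Nat.lcm p d = d := Nat.lcm_eq_right hpd
  have l4 : Nat.lcm d p = d := Nat.lcm_eq_left hpd
  have l5 : Nat.lcm q d = d := Nat.lcm_eq_right hqd
  have l6 : Nat.lcm d q = d := Nat.lcm_eq_left hqd
  have m1 := (mul_one d).symm
  have m2 := (one_mul d).symm
  have c1 : (Rect d d 1).card = d := by rw [card_Rect m1 m2 hd0 one_ne_zero, one_mul]
  have c2 : (Rect d 1 d).card = d := by rw [card_Rect m2 m1 one_ne_zero hd0, mul_one]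
  have c3 : (Rect d p q).card = d := by rw [card_Rect hd hd' hp0 hq0, ← hd']
  have c4 : (Rect d q p).card = d := by rw [card_Rect hd' hd hq0 hp0, ← hd]
  have c5 : (Rect d d d).card = 1 := by rw [card_Rect m1 m1 hd0 hd0, one_mul]
  have c6 : (Rect d d p).card = q := by rw [card_Rect m1 hd hd0 hp0, one_mul]
  have c7 : (Rect d d q).card = p := by rw [card_Rect m1 hd' hd0 hq0, one_mul]
  have c8 : (Rect d p d).card = q := by rw [card_Rect hd m1 hp0 hd0, mul_one]
  have c9 : (Rect d q d).card = p := by rw [card_Rect hd' m1 hq0 hd0, mul_one]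
  have key := card_three (Rect d (e1 d p q x) (e2 d p q x)) (Rect d (e1 d p q y) (e2 d p q y))
      (Rect d (e1 d p q z) (e2 d p q z))
  simp only [Rect_inter] at key
  rw [mul_assoc, ← hd]
  fin_cases x <;> fin_cases y <;> fin_cases z <;>
    first
    | exact absurd rfl hxy
    | exact absurd rfl hxz
    | exact absurd rfl hyz
    | (simp [e1, e2, l1, l2, l3, l4, l5, l6, c1, c2, c3, c4, c5, c6, c7, c8, c9] at key ⊢
       omega)

/-- For `d = pq` with `p, q` distinct primes and `X, Y, Z` any three
pairwise distinct sets among `A, B, C, D`, the real span of `X ∪ Y ∪ Z` has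
dimension `3pq − p − q`. -/
theorem stmt10 (p q d : ℕ) (hp : p.Prime) (hq : q.Prime) (hpq : p ≠ q)
    (hd : d = p * q) (X Y Z : Set (Matrix (Fin d) (Fin d) ℂ))
    (hX : X ∈ ({setA d, setB d, setC d p q, setD d p q} :
      Set (Set (Matrix (Fin d) (Fin d) ℂ))))
    (hY : Y ∈ ({setA d, setB d, setC d p q, setD d p q} :
      Set (Set (Matrix (Fin d) (Fin d) ℂ))))
    (hZ : Z ∈ ({setA d, setB d, setC d p q, setD d p q} :
      Set (Set (Matrix (Fin d) (Fin d) ℂ))))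
    (hXY : X ≠ Y) (hXZ : X ≠ Z) (hYZ : Y ≠ Z) :
    Module.finrank ℝ (Submodule.span ℝ (X ∪ Y ∪ Z)) = 3 * p * q - p - q := by
  obtain ⟨x, rfl⟩ := mem_fam hX
  obtain ⟨y, rfl⟩ := mem_fam hY
  obtain ⟨z, rfl⟩ := mem_fam hZ
  have hp0 := hp.ne_zero
  have hq0 := hq.ne_zero
  have hd0 : d ≠ 0 := by rw [hd]; exact mul_ne_zero hp0 hq0
  rw [finrank_real_eq_complex, Submodule.span_union, Submodule.span_union,
    span_fam hp0 hq0 hd, span_fam hp0 hq0 hd, span_fam hp0 hq0 hd,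
    ← Submodule.span_union, ← Submodule.span_union, ← Set.image_union, ← Set.image_union,
    ← Finset.coe_union, ← Finset.coe_union, finrank_weyl hd0]
  · exact count hp hq hpq hd x y z (fun h => hXY (h ▸ rfl)) (fun h => hXZ (h ▸ rfl))
      (fun h => hYZ (h ▸ rfl))
  · rintro M ((h | h) | h)
    exacts [herm_fam _ _ h, herm_fam _ _ h, herm_fam _ _ h]
end
end
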